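/- Let ρ > 1 and μ, ν ∈ P_ρ(ℝ). Let μ^ρ_{P̲(ν)} be the unique probability measure η with η ≤cx ν minimizing W_ρ(μ,η). Then the function (0,1) ∋ p ↦ F_{μ^ρ_{P̲(ν)}}^{-1}(p) − F_μ^{-1}(p) is non-increasing. -/

import Mathlib

open MeasureTheory ProbabilityTheory Set
open scoped ENNReal

noncomputable section

/-- `μ ≤cx ν`: convex order between measures on a normed space. -/
def ConvexOrder {E : Type*} [NormedAddCommGroup E] [NormedSpace ℝ E] [MeasurableSpace E]
    (μ ν : Measure E) : Prop :=
  (∀ φ : E → ℝ, ConvexOn ℝ univ φ → (∀ x, 0 ≤ φ x) →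
      ∫⁻ x, ENNReal.ofReal (φ x) ∂μ ≤ ∫⁻ x, ENNReal.ofReal (φ x) ∂ν) ∧
  (∀ φ : E → ℝ, ConvexOn ℝ univ φ → Integrable φ (μ + ν) →
      ∫ x, φ x ∂μ ≤ ∫ x, φ x ∂ν)

/-- `Wp ρ μ ν` is the ρ-th power `W_ρ(μ,ν)^ρ` of the ρ-Wasserstein distance. -/
def Wp {E : Type*} [NormedAddCommGroup E] [MeasurableSpace E]
    (ρ : ℝ) (μ ν : Measure E) : ℝ≥0∞ :=
  ⨅ (π : Measure (E × E)) (_ : π.map Prod.fst = μ) (_ : π.map Prod.snd = ν),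
    ∫⁻ p, ENNReal.ofReal (‖p.1 - p.2‖ ^ ρ) ∂π

/-- The quantile function `F_η^{-1}(p) = inf {x : F_η(x) ≥ p}` of a measure on `ℝ`. -/
def quantileFn (η : Measure ℝ) (p : ℝ) : ℝ :=
  sInf {x : ℝ | p ≤ (η (Iic x)).toReal}

/-! ### Quantile functions -/

lemma quantile_le_iff (η : Measure ℝ) [IsProbabilityMeasure η] {u : ℝ} (hu : u ∈ Ioo (0:ℝ) 1)
    (x : ℝ) : quantileFn η u ≤ x ↔ u ≤ (η (Iic x)).toReal := by
  have hF : ∀ y, (η (Iic y)).toReal = cdf η y := fun y => (cdf_eq_real η y).symm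
  unfold quantileFn
  simp only [hF]
  have hne : {x : ℝ | u ≤ cdf η x}.Nonempty := by
    have := (tendsto_cdf_atTop η).eventually (eventually_ge_nhds hu.2)
    exact this.exists
  have hbd : BddBelow {x : ℝ | u ≤ cdf η x} := by
    have := (tendsto_cdf_atBot η).eventually (eventually_lt_nhds hu.1)
    obtain ⟨b, hb⟩ := this.exists
    refine ⟨b, fun y hy => ?_⟩
    by_contra hlt
    have h1 := monotone_cdf η (not_le.1 hlt).le
    have h2 : u ≤ cdf η y := hy
    linarith
  constructor
  · intro h
    have hc : Filter.Tendsto (cdf η) (nhdsWithin x (Ioi x)) (nhds (cdf η x)) :=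
      ((cdf η).right_continuous x).mono_left (nhdsWithin_mono _ Ioi_subset_Ici_self)
    refine ge_of_tendsto hc ?_
    filter_upwards [self_mem_nhdsWithin] with y hy
    obtain ⟨s, hs, hsy⟩ := exists_lt_of_csInf_lt hne (lt_of_le_of_lt h hy)
    exact le_trans hs (monotone_cdf η hsy.le)
  · intro h
    exact csInf_le hbd h

lemma quantile_mono (η : Measure ℝ) [IsProbabilityMeasure η] :
    MonotoneOn (quantileFn η) (Ioo 0 1) := by
  intro u hu v hv huv
  rw [quantile_le_iff η hu]
  exact huv.trans ((quantile_le_iff η hv _).1 le_rfl)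

/-- The quantile function cut off outside `(0,1)`. -/
def Qf (η : Measure ℝ) : ℝ → ℝ := (Ioo (0:ℝ) 1).indicator (quantileFn η)

lemma Qf_eq (η : Measure ℝ) {u : ℝ} (hu : u ∈ Ioo (0:ℝ) 1) : Qf η u = quantileFn η u :=
  indicator_of_mem hu _

lemma measurable_Qf (η : Measure ℝ) [IsProbabilityMeasure η] : Measurable (Qf η) := by
  refine measurable_of_measurable_union_cover (Ioo 0 1) (Ioo (0:ℝ) 1)ᶜ measurableSet_Ioo
    measurableSet_Ioo.compl (union_compl_self _).ge ?_ ?_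
  · apply Monotone.measurable
    intro a b hab
    simp only [Qf_eq η a.2, Qf_eq η b.2]
    exact quantile_mono η a.2 b.2 hab
  · have : (fun a : ((Ioo (0:ℝ) 1)ᶜ : Set ℝ) => Qf η a) = fun _ => 0 := by
      ext a
      exact indicator_of_notMem a.2 _
    rw [this]
    exact measurable_const

/-- Lebesgue measure on `(0,1)`. -/
abbrev leb : Measure ℝ := volume.restrict (Ioo (0:ℝ) 1)

instance : IsProbabilityMeasure leb := ⟨by simp [leb]⟩

lemma map_Qf (η : Measure ℝ) [IsProbabilityMeasure η] : leb.map (Qf η) = η := by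
  have : IsProbabilityMeasure (leb.map (Qf η)) :=
    Measure.isProbabilityMeasure_map (measurable_Qf η).aemeasurable
  refine Measure.ext_of_Iic _ _ fun x => ?_
  rw [Measure.map_apply (measurable_Qf η) measurableSet_Iic,
    Measure.restrict_apply (measurable_Qf η measurableSet_Iic)]
  have h1 : Qf η ⁻¹' Iic x ∩ Ioo 0 1 = Iic (η (Iic x)).toReal ∩ Ioo 0 1 := by
    ext u
    simp only [mem_inter_iff, mem_preimage, mem_Iic]
    refine and_congr_left fun hu => ?_
    rw [Qf_eq η hu, quantile_le_iff η hu]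
  rw [h1]
  have hc : (η (Iic x)).toReal ≤ 1 := by
    simpa using (ENNReal.toReal_mono ENNReal.one_ne_top (prob_le_one : η (Iic x) ≤ 1))
  apply le_antisymm
  · calc _ ≤ volume (Ioc 0 (η (Iic x)).toReal) := measure_mono (fun u hu => (⟨hu.2.1, hu.1⟩ : u ∈ Ioc 0 (η (Iic x)).toReal))
      _ = _ := by simp
  · calc η (Iic x) = volume (Ioo 0 (η (Iic x)).toReal) := by simp
      _ ≤ _ := measure_mono (fun u hu =>
          (⟨hu.2.le, hu.1, hu.2.trans_le hc⟩ : u ∈ Iic (η (Iic x)).toReal ∩ Ioo 0 1))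

/-! ### Optimality of the comonotone coupling -/

lemma kernel_identity {ρ : ℝ} (hρ : 1 < ρ) (z : ℝ) :
    ENNReal.ofReal ((max z 0) ^ ρ) =
      ∫⁻ r in Ioi (0:ℝ), ENNReal.ofReal (ρ * (ρ - 1) * r ^ (ρ - 2)) * ENNReal.ofReal (z - r) := by
  rcases le_or_gt z 0 with hz | hz
  · rw [max_eq_right hz, Real.zero_rpow (by linarith), ENNReal.ofReal_zero]
    symm
    rw [setLIntegral_congr_fun (g := fun _ => 0) measurableSet_Ioi]
    · simp
    · intro r hr
      have : z - r ≤ 0 := by have := mem_Ioi.1 hr; linarith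
      simp [ENNReal.ofReal_of_nonpos this]
  · rw [max_eq_left hz.le]
    have hsplit : Ioi (0:ℝ) = Ioc 0 z ∪ Ioi z := (Ioc_union_Ioi_eq_Ioi hz.le).symm
    have hz0 : ∫⁻ r in Ioi z, ENNReal.ofReal (ρ * (ρ - 1) * r ^ (ρ - 2)) * ENNReal.ofReal (z - r)
        = 0 := by
      rw [setLIntegral_congr_fun (g := fun _ => 0) measurableSet_Ioi]
      · simp
      · intro r hr
        have : z - r ≤ 0 := by have := mem_Ioi.1 hr; linarith
        simp [ENNReal.ofReal_of_nonpos this]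
    rw [hsplit, lintegral_union measurableSet_Ioi (Ioc_disjoint_Ioi le_rfl), hz0, add_zero]
    have hi1 : IntervalIntegrable (fun r : ℝ => r ^ (ρ - 2)) volume 0 z :=
      intervalIntegral.intervalIntegrable_rpow' (by linarith)
    have hi2 : IntervalIntegrable (fun r : ℝ => r ^ (ρ - 1)) volume 0 z :=
      intervalIntegral.intervalIntegrable_rpow' (by linarith)
    have hcg : EqOn (fun r : ℝ => ENNReal.ofReal (ρ * (ρ - 1) * r ^ (ρ - 2)) * ENNReal.ofReal (z - r))
        (fun r => ENNReal.ofReal (ρ * (ρ - 1) * z * r ^ (ρ - 2) - ρ * (ρ - 1) * r ^ (ρ - 1)))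
        (Ioc 0 z) := by
      intro r hr
      have hr0 : 0 < r := hr.1
      simp only
      rw [← ENNReal.ofReal_mul]
      · congr 1
        have : r ^ (ρ - 1) = r ^ (ρ - 2) * r := by
          rw [← Real.rpow_add_one hr0.ne']; congr 1; ring
        rw [this]; ring
      · have := Real.rpow_nonneg hr0.le (ρ - 2)
        have h1 : 0 < ρ - 1 := by linarith
        positivity
    rw [setLIntegral_congr_fun measurableSet_Ioc hcg]
    have hi : IntervalIntegrable
        (fun r => ρ * (ρ - 1) * z * r ^ (ρ - 2) - ρ * (ρ - 1) * r ^ (ρ - 1)) volume 0 z :=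
      (hi1.const_mul _).sub (hi2.const_mul _)
    rw [← ofReal_integral_eq_lintegral_ofReal]
    · congr 1
      rw [← intervalIntegral.integral_of_le hz.le,
        intervalIntegral.integral_sub (hi1.const_mul _) (hi2.const_mul _),
        intervalIntegral.integral_const_mul, intervalIntegral.integral_const_mul,
        integral_rpow (Or.inl (by linarith)), integral_rpow (Or.inl (by linarith))]
      have e1 : ρ - 2 + 1 = ρ - 1 := by ring
      have e2 : ρ - 1 + 1 = ρ := by ring
      rw [e1, e2, Real.zero_rpow (by linarith), Real.zero_rpow (by linarith)]
      have : z ^ ρ = z ^ (ρ - 1) * z := by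
        rw [← Real.rpow_add_one hz.ne', e2]
      rw [this]
      have h1 : ρ - 1 ≠ 0 := by linarith
      have h2 : ρ ≠ 0 := by linarith
      field_simp
      ring
    · rwa [intervalIntegrable_iff_integrableOn_Ioc_of_le hz.le] at hi
    · filter_upwards [ae_restrict_mem measurableSet_Ioc] with r hr
      have hr0 : 0 < r := hr.1
      have : r ^ (ρ - 1) = r ^ (ρ - 2) * r := by
        rw [← Real.rpow_add_one hr0.ne']; congr 1; ring
      rw [this]
      have h0 := Real.rpow_nonneg hr0.le (ρ - 2)
      have h1 : 0 < ρ - 1 := by linarith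
      have h2 : 0 ≤ z - r := by linarith [hr.2]
      have : 0 ≤ ρ * (ρ - 1) * r ^ (ρ - 2) * (z - r) := by positivity
      simp only [Pi.zero_apply]
      linarith

lemma lintegral_pos_part {Ω : Type*} [MeasurableSpace Ω] (P : Measure Ω) [SFinite P]
    {X Y : Ω → ℝ} (hX : Measurable X) (hY : Measurable Y) (r : ℝ) :
    ∫⁻ w, ENNReal.ofReal (X w - Y w - r) ∂P = ∫⁻ t, P {w | Y w ≤ t - r ∧ t < X w} := by
  have hS : MeasurableSet {p : Ω × ℝ | Y p.1 ≤ p.2 - r ∧ p.2 < X p.1} :=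
    (measurableSet_le (hY.comp measurable_fst) (measurable_snd.sub_const r)).inter
      (measurableSet_lt measurable_snd (hX.comp measurable_fst))
  have h1 := Measure.prod_apply (μ := P) (ν := (volume : Measure ℝ)) hS
  have h2 := Measure.prod_apply_symm (μ := P) (ν := (volume : Measure ℝ)) hS
  rw [h1] at h2
  refine Eq.trans (lintegral_congr fun w => ?_) h2
  have : Prod.mk w ⁻¹' {p : Ω × ℝ | Y p.1 ≤ p.2 - r ∧ p.2 < X p.1} = Ico (Y w + r) (X w) := by
    ext t
    simp only [mem_preimage, mem_ofPred_eq, mem_Ico]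
    constructor <;> rintro ⟨h, h'⟩ <;> exact ⟨by linarith, h'⟩
  rw [this, Real.volume_Ico]
  congr 1; ring

lemma lintegral_pos_rpow {ρ : ℝ} (hρ : 1 < ρ) {Ω : Type*} [MeasurableSpace Ω] (P : Measure Ω)
    [SFinite P] {X Y : Ω → ℝ} (hX : Measurable X) (hY : Measurable Y) :
    ∫⁻ w, ENNReal.ofReal ((max (X w - Y w) 0) ^ ρ) ∂P =
      ∫⁻ r in Ioi (0:ℝ), ENNReal.ofReal (ρ * (ρ - 1) * r ^ (ρ - 2)) *
        ∫⁻ t, P {w | Y w ≤ t - r ∧ t < X w} := by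
  simp only [kernel_identity hρ]
  rw [lintegral_lintegral_swap (by
    apply Measurable.aemeasurable
    fun_prop)]
  refine lintegral_congr fun r => ?_
  rw [lintegral_const_mul _ (by fun_prop), lintegral_pos_part P hX hY]

lemma cost_le_half {ρ : ℝ} (hρ : 1 < ρ) {Ω Ω' : Type*} [MeasurableSpace Ω] [MeasurableSpace Ω']
    (P : Measure Ω) (P' : Measure Ω') [SFinite P] [SFinite P']
    {X Y : Ω → ℝ} {X' Y' : Ω' → ℝ} (hX : Measurable X) (hY : Measurable Y)
    (hX' : Measurable X') (hY' : Measurable Y')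
    (h : ∀ s t, P {w | Y w ≤ s ∧ t < X w} ≤ P' {w | Y' w ≤ s ∧ t < X' w}) :
    ∫⁻ w, ENNReal.ofReal ((max (X w - Y w) 0) ^ ρ) ∂P ≤
      ∫⁻ w, ENNReal.ofReal ((max (X' w - Y' w) 0) ^ ρ) ∂P' := by
  rw [lintegral_pos_rpow hρ P hX hY, lintegral_pos_rpow hρ P' hX' hY']
  gcongr with r t
  exact h _ _

lemma como_le {μ η : Measure ℝ} [IsProbabilityMeasure μ] [IsProbabilityMeasure η]
    {Ω : Type*} [MeasurableSpace Ω] (P : Measure Ω) {X Y : Ω → ℝ} (hX : Measurable X)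
    (hY : Measurable Y) (hXμ : P.map X = μ) (hYη : P.map Y = η) (s t : ℝ) :
    leb {u | Qf η u ≤ s ∧ t < Qf μ u} ≤ P {w | Y w ≤ s ∧ t < X w} := by
  have hA : leb {u | Qf η u ≤ s ∧ t < Qf μ u} ≤ η (Iic s) - μ (Iic t) := by
    have hm : MeasurableSet {u | Qf η u ≤ s ∧ t < Qf μ u} :=
      (measurableSet_le (measurable_Qf η) measurable_const).inter
        (measurableSet_lt measurable_const (measurable_Qf μ))
    rw [Measure.restrict_apply hm]
    calc _ ≤ volume (Ioc (μ (Iic t)).toReal (η (Iic s)).toReal) := by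
          refine measure_mono ?_
          rintro u ⟨⟨h1, h2⟩, hu⟩
          rw [Qf_eq η hu, quantile_le_iff η hu] at h1
          rw [Qf_eq μ hu, ← not_le, quantile_le_iff μ hu, not_le] at h2
          exact ⟨h2, h1⟩
      _ = _ := by
          rw [Real.volume_Ioc, ENNReal.ofReal_sub _ ENNReal.toReal_nonneg,
            ENNReal.ofReal_toReal (measure_ne_top _ _), ENNReal.ofReal_toReal (measure_ne_top _ _)]
  refine hA.trans ?_
  rw [tsub_le_iff_right, ← hXμ, ← hYη, Measure.map_apply hX measurableSet_Iic,
    Measure.map_apply hY measurableSet_Iic]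
  refine le_trans (measure_mono ?_) (measure_union_le _ _)
  intro w hw
  by_cases h : t < X w
  · exact Or.inl ⟨hw, h⟩
  · exact Or.inr (not_lt.1 h)

lemma abs_rpow_split {ρ : ℝ} (hρ : 1 < ρ) (x y : ℝ) :
    ENNReal.ofReal (|x - y| ^ ρ) =
      ENNReal.ofReal ((max (x - y) 0) ^ ρ) + ENNReal.ofReal ((max (y - x) 0) ^ ρ) := by
  have h0 : (0:ℝ) ^ ρ = 0 := Real.zero_rpow (by linarith)
  rcases le_total x y with h | h
  · rw [max_eq_right (by linarith : x - y ≤ 0), max_eq_left (by linarith : 0 ≤ y - x),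
      abs_of_nonpos (by linarith), h0]
    simp
  · rw [max_eq_left (by linarith : 0 ≤ x - y), max_eq_right (by linarith : y - x ≤ 0),
      abs_of_nonneg (by linarith), h0]
    simp

/-- The comonotone coupling is optimal. -/
lemma como_optimal {ρ : ℝ} (hρ : 1 < ρ) {μ η : Measure ℝ} [IsProbabilityMeasure μ]
    [IsProbabilityMeasure η] :
    ∫⁻ u, ENNReal.ofReal (|Qf μ u - Qf η u| ^ ρ) ∂leb ≤ Wp ρ μ η := by
  unfold Wp
  refine le_iInf fun π => le_iInf fun h1 => le_iInf fun h2 => ?_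
  have hπ : IsProbabilityMeasure π := by
    constructor
    have : π.map Prod.fst univ = 1 := by rw [h1]; exact measure_univ
    rwa [Measure.map_apply measurable_fst MeasurableSet.univ] at this
  have hG := measurable_Qf μ
  have hH := measurable_Qf η
  simp only [Real.norm_eq_abs, abs_rpow_split hρ]
  rw [lintegral_add_left (by fun_prop), lintegral_add_left (by fun_prop)]
  refine add_le_add ?_ ?_
  · exact cost_le_half hρ leb π hG hH measurable_fst measurable_snd
      (como_le π measurable_fst measurable_snd h1 h2)
  · exact cost_le_half hρ leb π hH hG measurable_snd measurable_fst
      (como_le π measurable_snd measurable_fst h2 h1)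

/-- Any coupling realised on `(0,1)` bounds `Wp`. -/
lemma Wp_le {ρ : ℝ} {μ η : Measure ℝ} {X Y : ℝ → ℝ} (hX : Measurable X) (hY : Measurable Y)
    (hXμ : leb.map X = μ) (hYη : leb.map Y = η) :
    Wp ρ μ η ≤ ∫⁻ u, ENNReal.ofReal (|X u - Y u| ^ ρ) ∂leb := by
  unfold Wp
  refine (iInf_le _ (leb.map fun u => (X u, Y u))).trans ?_
  have hXY : Measurable fun u => (X u, Y u) := hX.prodMk hY
  refine (iInf_le _ (by rw [Measure.map_map measurable_fst hXY]; exact hXμ)).trans ?_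
  refine (iInf_le _ (by rw [Measure.map_map measurable_snd hXY]; exact hYη)).trans ?_
  rw [lintegral_map (by fun_prop) hXY]
  simp

/-! ### Convexity -/

lemma convex_swap {φ : ℝ → ℝ} (hφ : ConvexOn ℝ univ φ) {a b t : ℝ} (hab : a < b) (ht : 0 ≤ t)
    (htb : t ≤ b - a) : φ (a + t) + φ (b - t) ≤ φ a + φ b := by
  have hd : 0 < b - a := by linarith
  set l := t / (b - a) with hl
  have hl0 : 0 ≤ l := div_nonneg ht hd.le
  have hl1 : l ≤ 1 := (div_le_one hd).2 htb
  have hlt : l * (b - a) = t := div_mul_cancel₀ _ hd.ne'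
  have h1 := hφ.2 (mem_univ a) (mem_univ b) (sub_nonneg.2 hl1) hl0 (by ring)
  have h2 := hφ.2 (mem_univ a) (mem_univ b) hl0 (sub_nonneg.2 hl1) (by ring)
  simp only [smul_eq_mul] at h1 h2
  have e1 : (1 - l) * a + l * b = a + t := by linarith
  have e2 : l * a + (1 - l) * b = b - t := by linarith
  rw [e1] at h1
  rw [e2] at h2
  linarith

lemma strictConvex_swap {φ : ℝ → ℝ} (hφ : StrictConvexOn ℝ univ φ) {a b t : ℝ} (ht : 0 < t)
    (htb : t < b - a) : φ (a + t) + φ (b - t) < φ a + φ b := by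
  have hd : 0 < b - a := by linarith
  have hab : a ≠ b := by intro h; linarith
  set l := t / (b - a) with hl
  have hl0 : 0 < l := div_pos ht hd
  have hl1 : l < 1 := (div_lt_one hd).2 htb
  have hlt : l * (b - a) = t := div_mul_cancel₀ _ hd.ne'
  have h1 := hφ.2 (mem_univ a) (mem_univ b) hab (sub_pos.2 hl1) hl0 (by ring)
  have h2 := hφ.2 (mem_univ a) (mem_univ b) hab hl0 (sub_pos.2 hl1) (by ring)
  simp only [smul_eq_mul] at h1 h2
  have e1 : (1 - l) * a + l * b = a + t := by linarith
  have e2 : l * a + (1 - l) * b = b - t := by linarith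
  rw [e1] at h1
  rw [e2] at h2
  linarith

lemma strictConvex_abs_rpow {ρ : ℝ} (hρ : 1 < ρ) :
    StrictConvexOn ℝ univ (fun x : ℝ => |x| ^ ρ) := by
  refine ⟨convex_univ, ?_⟩
  intro x _ y _ hxy a b ha hb hab
  simp only [smul_eq_mul]
  have htri : |a * x + b * y| ≤ a * |x| + b * |y| := by
    calc _ ≤ |a * x| + |b * y| := abs_add_le _ _
      _ = _ := by rw [abs_mul, abs_mul, abs_of_pos ha, abs_of_pos hb]
  by_cases h : |x| = |y|
  · have hx : y = -x := by
      rcases abs_eq_abs.1 h with h | h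
      · exact absurd h hxy
      · linarith
    have hx0 : x ≠ 0 := by rintro rfl; apply hxy; simp [hx]
    have hlt : |a * x + b * y| < |x| := by
      have : a * x + b * y = (a - b) * x := by rw [hx]; ring
      rw [this, abs_mul]
      have : |a - b| < 1 := abs_lt.2 ⟨by linarith, by linarith⟩
      have := mul_lt_mul_of_pos_right this (abs_pos.2 hx0)
      linarith
    have := Real.rpow_lt_rpow (abs_nonneg _) hlt (by linarith : 0 < ρ)
    rw [← h]
    have e : a * |x| ^ ρ + b * |x| ^ ρ = |x| ^ ρ := by rw [← add_mul, hab, one_mul]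
    linarith
  · have h1 := (strictConvexOn_rpow hρ).2 (abs_nonneg x) (abs_nonneg y) h ha hb hab
    simp only [smul_eq_mul] at h1
    have h2 := Real.rpow_le_rpow (abs_nonneg _) htri (by linarith : 0 ≤ ρ)
    linarith

lemma convex_continuous {φ : ℝ → ℝ} (hφ : ConvexOn ℝ univ φ) : Continuous φ :=
  continuousOn_univ.1 (hφ.continuousOn isOpen_univ)

/-! ### Splitting the integral -/

lemma split_lintegral {p q ε : ℝ} (hp : 0 ≤ p - ε) (hpq : p ≤ q - ε) (hq : q < 1) (hε : 0 < ε)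
    {f : ℝ → ℝ≥0∞} (hf : Measurable f) :
    ∫⁻ u, f u ∂leb = (∫⁻ u in Ioo 0 1 \ (Ioc (p - ε) p ∪ Ioc (q - ε) q), f u) +
      ∫⁻ u in Ioc (p - ε) p, (f u + f (u + (q - p))) := by
  have hsub : Ioc (p - ε) p ∪ Ioc (q - ε) q ⊆ Ioo (0:ℝ) 1 := by
    rintro u (⟨h1, h2⟩ | ⟨h1, h2⟩) <;> exact ⟨by linarith, by linarith⟩
  have hdis : Disjoint (Ioc (p - ε) p) (Ioc (q - ε) q) := by
    rw [Set.disjoint_left]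
    rintro u ⟨_, h2⟩ ⟨h3, _⟩
    linarith
  have hmU : MeasurableSet (Ioc (p - ε) p ∪ Ioc (q - ε) q) := measurableSet_Ioc.union measurableSet_Ioc
  have e : Ioo (0:ℝ) 1 = Ioo 0 1 \ (Ioc (p - ε) p ∪ Ioc (q - ε) q) ∪
      (Ioc (p - ε) p ∪ Ioc (q - ε) q) := (sdiff_union_of_subset hsub).symm
  have hshift : ∫⁻ u in Ioc (p - ε) p, f (u + (q - p)) = ∫⁻ u in Ioc (q - ε) q, f u := by
    have := (measurePreserving_add_right (volume : Measure ℝ) (q - p)).setLIntegral_comp_preimage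
      (measurableSet_Ioc (a := q - ε) (b := q)) hf
    rw [← this]
    congr 2
    ext u
    simp only [mem_preimage, mem_Ioc]
    constructor <;> rintro ⟨h, h'⟩ <;> exact ⟨by linarith, by linarith⟩
  rw [lintegral_add_left hf, hshift, ← lintegral_union measurableSet_Ioc hdis,
    ← lintegral_union hmU disjoint_sdiff_left, ← e]

/-- The perturbation of `H`. -/
def pert (H : ℝ → ℝ) (p q ε t : ℝ) : ℝ → ℝ := fun u =>
  H u + (Ioc (p - ε) p).indicator (fun _ => t) u - (Ioc (q - ε) q).indicator (fun _ => t) u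

lemma pert_A (H : ℝ → ℝ) {p q ε : ℝ} (t : ℝ) (hpq : p ≤ q - ε) {u : ℝ}
    (hu : u ∈ Ioc (p - ε) p) : pert H p q ε t u = H u + t := by
  have : u ∉ Ioc (q - ε) q := fun h => by linarith [h.1, hu.2]
  simp [pert, indicator_of_mem hu, indicator_of_notMem this]

lemma pert_B (H : ℝ → ℝ) {p q ε : ℝ} (t : ℝ) (hpq : p ≤ q - ε) {u : ℝ}
    (hu : u ∈ Ioc (q - ε) q) : pert H p q ε t u = H u - t := by
  have : u ∉ Ioc (p - ε) p := fun h => by linarith [h.2, hu.1]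
  simp [pert, indicator_of_mem hu, indicator_of_notMem this]

lemma pert_C (H : ℝ → ℝ) {p q ε : ℝ} (t : ℝ) {u : ℝ}
    (hu : u ∉ Ioc (p - ε) p ∪ Ioc (q - ε) q) : pert H p q ε t u = H u := by
  have h1 : u ∉ Ioc (p - ε) p := fun h => hu (Or.inl h)
  have h2 : u ∉ Ioc (q - ε) q := fun h => hu (Or.inr h)
  simp [pert, indicator_of_notMem h1, indicator_of_notMem h2]

lemma measurable_pert {H : ℝ → ℝ} (hH : Measurable H) (p q ε t : ℝ) :
    Measurable (pert H p q ε t) :=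
  (hH.add (measurable_const.indicator measurableSet_Ioc)).sub
    (measurable_const.indicator measurableSet_Ioc)

lemma shift_mem {p q ε u : ℝ} (hu : u ∈ Ioc (p - ε) p) : u + (q - p) ∈ Ioc (q - ε) q :=
  ⟨by linarith [hu.1], by linarith [hu.2]⟩

lemma pert_convex {p q ε t : ℝ} (hp : 0 ≤ p - ε) (hpq : p ≤ q - ε) (hq : q < 1) (hε : 0 < ε)
    {H : ℝ → ℝ} (hH : Measurable H) (ht : 0 < t)
    (hgap : ∀ u ∈ Ioc (p - ε) p, t ≤ H (u + (q - p)) - H u)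
    {φ : ℝ → ℝ} (hφ : ConvexOn ℝ univ φ) (hφ0 : ∀ x, 0 ≤ φ x) :
    ∫⁻ u, ENNReal.ofReal (φ (pert H p q ε t u)) ∂leb ≤ ∫⁻ u, ENNReal.ofReal (φ (H u)) ∂leb := by
  have hc := (convex_continuous hφ).measurable
  have hP := measurable_pert hH p q ε t
  have m1 : Measurable fun u => ENNReal.ofReal (φ (pert H p q ε t u)) :=
    (hc.comp hP).ennreal_ofReal
  have m2 : Measurable fun u => ENNReal.ofReal (φ (H u)) := (hc.comp hH).ennreal_ofReal
  rw [split_lintegral hp hpq hq hε m1, split_lintegral hp hpq hq hε m2]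
  refine add_le_add (le_of_eq ?_) ?_
  · refine setLIntegral_congr_fun
      (measurableSet_Ioo.diff (measurableSet_Ioc.union measurableSet_Ioc)) fun u hu => ?_
    simp only [pert_C H t hu.2]
  · refine setLIntegral_mono' measurableSet_Ioc fun u hu => ?_
    rw [pert_A H t hpq hu, pert_B H t hpq (shift_mem hu),
      ← ENNReal.ofReal_add (hφ0 _) (hφ0 _), ← ENNReal.ofReal_add (hφ0 _) (hφ0 _)]
    have hg := hgap u hu
    exact ENNReal.ofReal_le_ofReal (convex_swap hφ (by linarith) ht.le (by linarith))

lemma pert_cost {ρ : ℝ} (hρ : 1 < ρ) {p q ε t : ℝ} (hp : 0 ≤ p - ε) (hpq : p ≤ q - ε) (hq : q < 1)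
    (hε : 0 < ε) {G H : ℝ → ℝ} (hG : Measurable G) (hH : Measurable H) (ht : 0 < t)
    (hgap : ∀ u ∈ Ioc (p - ε) p, t < (H (u + (q - p)) - G (u + (q - p))) - (H u - G u))
    (hfin : ∫⁻ u, ENNReal.ofReal (|G u - H u| ^ ρ) ∂leb ≠ ⊤) :
    ∫⁻ u, ENNReal.ofReal (|G u - pert H p q ε t u| ^ ρ) ∂leb <
      ∫⁻ u, ENNReal.ofReal (|G u - H u| ^ ρ) ∂leb := by
  have hP := measurable_pert hH p q ε t
  have m1 : Measurable fun u => ENNReal.ofReal (|G u - pert H p q ε t u| ^ ρ) := by fun_prop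
  have m2 : Measurable fun u => ENNReal.ofReal (|G u - H u| ^ ρ) := by fun_prop
  have key : ∀ u ∈ Ioc (p - ε) p,
      ENNReal.ofReal (|G u - pert H p q ε t u| ^ ρ) +
        ENNReal.ofReal (|G (u + (q - p)) - pert H p q ε t (u + (q - p))| ^ ρ) <
      ENNReal.ofReal (|G u - H u| ^ ρ) +
        ENNReal.ofReal (|G (u + (q - p)) - H (u + (q - p))| ^ ρ) := by
    intro u hu
    have h0 : ∀ x : ℝ, 0 ≤ |x| ^ ρ := fun x => Real.rpow_nonneg (abs_nonneg x) ρ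
    rw [pert_A H t hpq hu, pert_B H t hpq (shift_mem hu),
      ← ENNReal.ofReal_add (h0 _) (h0 _), ← ENNReal.ofReal_add (h0 _) (h0 _)]
    have hs := strictConvex_swap (strictConvex_abs_rpow hρ) ht (hgap u hu)
    rw [abs_sub_comm (G u) (H u + t), abs_sub_comm (G u) (H u),
      abs_sub_comm (G (u + (q - p))) (H (u + (q - p)) - t),
      abs_sub_comm (G (u + (q - p))) (H (u + (q - p)))]
    rw [ENNReal.ofReal_lt_ofReal_iff']
    have e1 : H u + t - G u = H u - G u + t := by ring
    have e2 : H (u + (q - p)) - t - G (u + (q - p)) = H (u + (q - p)) - G (u + (q - p)) - t := by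
      ring
    rw [e1, e2]
    refine ⟨hs, lt_of_le_of_lt ?_ hs⟩
    exact add_nonneg (h0 _) (h0 _)
  rw [split_lintegral hp hpq hq hε m2] at hfin ⊢
  rw [split_lintegral hp hpq hq hε m1]
  have hrest : ∫⁻ u in Ioo 0 1 \ (Ioc (p - ε) p ∪ Ioc (q - ε) q),
      ENNReal.ofReal (|G u - pert H p q ε t u| ^ ρ) =
      ∫⁻ u in Ioo 0 1 \ (Ioc (p - ε) p ∪ Ioc (q - ε) q), ENNReal.ofReal (|G u - H u| ^ ρ) := by
    refine setLIntegral_congr_fun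
      (measurableSet_Ioo.diff (measurableSet_Ioc.union measurableSet_Ioc)) fun u hu => ?_
    simp only [pert_C H t hu.2]
  rw [hrest]
  rw [ENNReal.add_ne_top] at hfin
  refine ENNReal.add_lt_add_left hfin.1 ?_
  refine setLIntegral_strict_mono measurableSet_Ioc (by simp [hε]) (by fun_prop) ?_
    (Filter.Eventually.of_forall key)
  refine ne_top_of_le_ne_top hfin.2 ?_
  exact setLIntegral_mono' measurableSet_Ioc fun u hu => (key u hu).le

lemma pert_integral {p q ε t : ℝ} (hp : 0 ≤ p - ε) (hpq : p ≤ q - ε) (hq : q < 1) (hε : 0 < ε)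
    {H : ℝ → ℝ} (hH : Integrable H leb) :
    Integrable (pert H p q ε t) leb ∧ ∫ u, pert H p q ε t u ∂leb = ∫ u, H u ∂leb := by
  have i1 : Integrable ((Ioc (p - ε) p).indicator fun _ => t) leb :=
    (integrable_const t).indicator measurableSet_Ioc
  have i2 : Integrable ((Ioc (q - ε) q).indicator fun _ => t) leb :=
    (integrable_const t).indicator measurableSet_Ioc
  refine ⟨(hH.add i1).sub i2, ?_⟩
  unfold pert
  have hA : Ioc (p - ε) p ∩ Ioo 0 1 = Ioc (p - ε) p :=
    inter_eq_left.2 fun u hu => ⟨by linarith [hu.1], by linarith [hu.2]⟩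
  have hB : Ioc (q - ε) q ∩ Ioo 0 1 = Ioc (q - ε) q :=
    inter_eq_left.2 fun u hu => ⟨by linarith [hu.1], by linarith [hu.2]⟩
  rw [integral_sub (by exact hH.add i1) i2, integral_add hH i1,
    integral_indicator_const _ measurableSet_Ioc, integral_indicator_const _ measurableSet_Ioc]
  simp only [Measure.real, Measure.restrict_apply measurableSet_Ioc, hA, hB, Real.volume_Ioc]
  simp

/-! ### Convex order -/

lemma integrable_id_of_rpow {ρ : ℝ} (hρ : 1 < ρ) {ν : Measure ℝ} [IsProbabilityMeasure ν]
    (hν : Integrable (fun x => |x| ^ ρ) ν) : Integrable (fun x : ℝ => x) ν := by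
  refine Integrable.mono' ((integrable_const (1:ℝ)).add hν) measurable_id.aestronglyMeasurable
    (Filter.Eventually.of_forall fun x => ?_)
  simp only [Real.norm_eq_abs, Pi.add_apply]
  rcases le_total |x| 1 with h | h
  · have := Real.rpow_nonneg (abs_nonneg x) ρ
    linarith
  · have := Real.rpow_le_rpow_of_exponent_le h hρ.le
    rw [Real.rpow_one] at this
    linarith

lemma integrable_of_convexOrder {η ν : Measure ℝ} (h : ConvexOrder η ν) {φ : ℝ → ℝ}
    (hφ : ConvexOn ℝ univ φ) (hφ0 : ∀ x, 0 ≤ φ x) (hi : Integrable φ ν) : Integrable φ η := by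
  refine ⟨(convex_continuous hφ).aestronglyMeasurable, ?_⟩
  rw [hasFiniteIntegral_iff_ofReal (Filter.Eventually.of_forall hφ0)]
  refine lt_of_le_of_lt (h.1 φ hφ hφ0) ?_
  rw [← hasFiniteIntegral_iff_ofReal (Filter.Eventually.of_forall hφ0)]
  exact hi.2

lemma convexOrder_of_nonneg {η ν : Measure ℝ} [IsProbabilityMeasure η] [IsProbabilityMeasure ν]
    (hη : Integrable (fun x : ℝ => x) η) (hν : Integrable (fun x : ℝ => x) ν)
    (hmean : ∫ x, x ∂η = ∫ x, x ∂ν)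
    (h : ∀ φ : ℝ → ℝ, ConvexOn ℝ univ φ → (∀ x, 0 ≤ φ x) →
      ∫⁻ x, ENNReal.ofReal (φ x) ∂η ≤ ∫⁻ x, ENNReal.ofReal (φ x) ∂ν) : ConvexOrder η ν := by
  refine ⟨h, fun φ hφ hi => ?_⟩
  rw [integrable_add_measure] at hi
  obtain ⟨a, b, hab⟩ : ∃ a b : ℝ, ∀ x, a * x + b ≤ φ x := by
    obtain ⟨a, b, hab⟩ := ConvexOn.exists_affine_le_real (s := univ) (f := φ) isClosed_univ
      ((convex_continuous hφ).lowerSemicontinuous.lowerSemicontinuousOn _) hφ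
    exact ⟨a, b, fun x => hab x (mem_univ x)⟩
  have hψ : ConvexOn ℝ univ fun x => φ x - (a * x + b) := by
    refine ⟨convex_univ, fun x _ y _ c d hc hd hcd => ?_⟩
    have := hφ.2 (mem_univ x) (mem_univ y) hc hd hcd
    simp only [smul_eq_mul] at this ⊢
    have e : b = c * b + d * b := by rw [← add_mul, hcd, one_mul]
    nlinarith
  have hψ0 : ∀ x, 0 ≤ φ x - (a * x + b) := fun x => sub_nonneg.2 (hab x)
  have l1 : Integrable (fun x => a * x + b) η := (hη.const_mul a).add (integrable_const b)
  have l2 : Integrable (fun x => a * x + b) ν := (hν.const_mul a).add (integrable_const b)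
  have key := h _ hψ hψ0
  have s1 : Integrable (fun x => φ x - (a * x + b)) η := hi.1.sub l1
  have s2 : Integrable (fun x => φ x - (a * x + b)) ν := hi.2.sub l2
  rw [← ofReal_integral_eq_lintegral_ofReal s1 (Filter.Eventually.of_forall hψ0),
    ← ofReal_integral_eq_lintegral_ofReal s2 (Filter.Eventually.of_forall hψ0),
    ENNReal.ofReal_le_ofReal_iff (integral_nonneg (μ := ν) hψ0), integral_sub hi.1 l1,
    integral_sub hi.2 l2, integral_add (hη.const_mul a) (integrable_const b),
    integral_add (hν.const_mul a) (integrable_const b), integral_const_mul, integral_const_mul,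
    hmean] at key
  simp at key
  exact key

/-- Left continuity of the quantile function, one sided form. -/
lemma quantile_left (η : Measure ℝ) [IsProbabilityMeasure η] {p δ : ℝ} (hp : p ∈ Ioo (0:ℝ) 1)
    (hδ : 0 < δ) : ∃ e > 0, ∀ u ∈ Ioo (0:ℝ) 1, p - e < u → quantileFn η p - δ < quantileFn η u := by
  refine ⟨p - (η (Iic (quantileFn η p - δ))).toReal, ?_, fun u hu h => ?_⟩
  · have : ¬ quantileFn η p ≤ quantileFn η p - δ := by linarith
    rw [quantile_le_iff η hp] at this
    linarith
  · by_contra hc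
    rw [not_lt, quantile_le_iff η hu] at hc
    linarith

/-- for `ρ > 1` and `μ, ν ∈ P_ρ(ℝ)`, the quantile function of the
`W_ρ`-projection `η` of `μ` on `{η : η ≤cx ν}` satisfies that
`p ↦ F_η^{-1}(p) - F_μ^{-1}(p)` is non-increasing on `(0,1)`. -/
theorem stmt5 (ρ : ℝ) (hρ : 1 < ρ) (μ ν η : Measure ℝ)
    [IsProbabilityMeasure μ] [IsProbabilityMeasure ν] [IsProbabilityMeasure η]
    (hμρ : Integrable (fun x => |x| ^ ρ) μ) (hνρ : Integrable (fun x => |x| ^ ρ) ν)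
    (hcx : ConvexOrder η ν)
    (hmin : Wp ρ μ η = ⨅ (η' : Measure ℝ) (_ : IsProbabilityMeasure η')
        (_ : ConvexOrder η' ν), Wp ρ μ η') :
    AntitoneOn (fun p => quantileFn η p - quantileFn μ p) (Ioo 0 1) := by
  intro p hp q hq hpq
  by_contra hcon
  simp only [not_le] at hcon
  have hpq' : p < q := by
    rcases hpq.lt_or_eq with h | h
    · exact h
    · subst h; exact absurd hcon (lt_irrefl _)
  obtain ⟨t, ht0, ht⟩ : ∃ t > 0, quantileFn η q - quantileFn μ q
      = quantileFn η p - quantileFn μ p + 3 * t :=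
    ⟨((quantileFn η q - quantileFn μ q) - (quantileFn η p - quantileFn μ p)) / 3,
      by linarith, by ring⟩
  obtain ⟨e1, he1, hl1⟩ := quantile_left μ hp ht0
  obtain ⟨e2, he2, hl2⟩ := quantile_left η hq ht0
  obtain ⟨ε, hε, hεp, hεd, hεe1, hεe2⟩ : ∃ ε > 0, ε ≤ p ∧ ε ≤ q - p ∧ ε ≤ e1 ∧ ε ≤ e2 :=
    ⟨min (min p (q - p)) (min e1 e2), by
      simp only [gt_iff_lt, lt_min_iff]; exact ⟨⟨hp.1, by linarith⟩, he1, he2⟩,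
      (min_le_left _ _).trans (min_le_left _ _), (min_le_left _ _).trans (min_le_right _ _),
      (min_le_right _ _).trans (min_le_left _ _), (min_le_right _ _).trans (min_le_right _ _)⟩
  have b1 : 0 ≤ p - ε := by linarith
  have b2 : p ≤ q - ε := by linarith
  have b3 : q < 1 := hq.2
  have hgap : ∀ u ∈ Ioc (p - ε) p,
      t < (Qf η (u + (q - p)) - Qf μ (u + (q - p))) - (Qf η u - Qf μ u) ∧
      Qf μ u ≤ Qf μ (u + (q - p)) := by
    intro u hu
    have hu1 : u ∈ Ioo (0:ℝ) 1 := ⟨by linarith [hu.1], by linarith [hu.2]⟩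
    have hu2 : u + (q - p) ∈ Ioo (0:ℝ) 1 := ⟨by linarith [hu.1], by linarith [hu.2]⟩
    rw [Qf_eq η hu1, Qf_eq η hu2, Qf_eq μ hu1, Qf_eq μ hu2]
    have g1 := hl1 u hu1 (by linarith [hu.1])
    have g2 := hl2 (u + (q - p)) hu2 (by linarith [hu.1])
    have g3 := quantile_mono η hu1 hp hu.2
    have g4 := quantile_mono μ hu2 hq (by linarith [hu.2])
    exact ⟨by linarith, quantile_mono μ hu1 hu2 (by linarith)⟩
  have hG := measurable_Qf μ
  have hH := measurable_Qf η
  have hηρ : Integrable (fun x => |x| ^ ρ) η :=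
    integrable_of_convexOrder hcx (strictConvex_abs_rpow hρ).convexOn
      (fun x => Real.rpow_nonneg (abs_nonneg x) ρ) hνρ
  have hη1 := integrable_id_of_rpow hρ hηρ
  have hν1 := integrable_id_of_rpow hρ hνρ
  -- the finite cost
  have hfin : ∫⁻ u, ENNReal.ofReal (|Qf μ u - Qf η u| ^ ρ) ∂leb ≠ ⊤ := by
    have i1 : Integrable (fun u => |Qf μ u| ^ ρ) leb := by
      rw [← map_Qf μ] at hμρ
      exact hμρ.comp_measurable hG
    have i2 : Integrable (fun u => |Qf η u| ^ ρ) leb := by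
      rw [← map_Qf η] at hηρ
      exact hηρ.comp_measurable hH
    have i3 := (i1.add i2).const_mul (2 ^ (ρ - 1))
    have hle : ∀ u, |Qf μ u - Qf η u| ^ ρ ≤ 2 ^ (ρ - 1) * (|Qf μ u| ^ ρ + |Qf η u| ^ ρ) := by
      intro u
      refine (Real.rpow_le_rpow (abs_nonneg _) (abs_sub _ _) (by linarith)).trans ?_
      have h := NNReal.rpow_add_le_mul_rpow_add_rpow ⟨|Qf μ u|, abs_nonneg _⟩
        ⟨|Qf η u|, abs_nonneg _⟩ hρ.le
      exact h
    refine ne_top_of_le_ne_top ?_ (lintegral_mono fun u => ENNReal.ofReal_le_ofReal (hle u))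
    exact i3.lintegral_lt_top.ne
  -- the competitor
  have hP := measurable_pert hH p q ε t
  have hprob : IsProbabilityMeasure (leb.map (pert (Qf η) p q ε t)) :=
    Measure.isProbabilityMeasure_map hP.aemeasurable
  have hHi : Integrable (Qf η) leb := by
    have h := hη1
    rw [← map_Qf η] at h
    exact h.comp_measurable hH
  obtain ⟨hPi, hPm⟩ := pert_integral (t := t) b1 b2 b3 hε hHi
  have hmap : ∀ φ : ℝ → ℝ, ConvexOn ℝ univ φ → ∀ Z : ℝ → ℝ, Measurable Z →
      ∫⁻ x, ENNReal.ofReal (φ x) ∂(leb.map Z) = ∫⁻ u, ENNReal.ofReal (φ (Z u)) ∂leb :=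
    fun φ hφ Z hZ => lintegral_map (convex_continuous hφ).measurable.ennreal_ofReal hZ
  have hmeanη : ∫ x, x ∂η = ∫ x, x ∂ν := by
    have c1 : ConvexOn ℝ univ fun x : ℝ => x := convexOn_id convex_univ
    have c2 : ConvexOn ℝ univ fun x : ℝ => -x := (concaveOn_id convex_univ).neg
    have h1 := hcx.2 _ c1 (integrable_add_measure.2 ⟨hη1, hν1⟩)
    have h2 := hcx.2 _ c2 (integrable_add_measure.2 ⟨hη1.neg, hν1.neg⟩)
    rw [integral_neg, integral_neg] at h2
    linarith
  have hmeanH : ∫ u, Qf η u ∂leb = ∫ x, x ∂η := by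
    have := integral_map (μ := leb) hH.aemeasurable
      (f := fun x : ℝ => x) measurable_id.aestronglyMeasurable
    rw [map_Qf η] at this
    exact this.symm
  have hcx' : ConvexOrder (leb.map (pert (Qf η) p q ε t)) ν := by
    refine convexOrder_of_nonneg ?_ hν1 ?_ fun φ hφ hφ0 => ?_
    · exact (integrable_map_measure (g := fun x : ℝ => x) measurable_id.aestronglyMeasurable
        hP.aemeasurable).2 hPi
    · rw [integral_map (f := fun x : ℝ => x) hP.aemeasurable measurable_id.aestronglyMeasurable,
        hPm, hmeanH, hmeanη]
    · refine le_trans ?_ (hcx.1 φ hφ hφ0)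
      have h2 := hmap φ hφ _ hH
      rw [map_Qf η] at h2
      rw [hmap φ hφ _ hP, h2]
      refine pert_convex b1 b2 b3 hε hH ht0 (fun u hu => ?_) hφ hφ0
      have := hgap u hu
      linarith [this.1, this.2]
  have hle : Wp ρ μ η ≤ Wp ρ μ (leb.map (pert (Qf η) p q ε t)) := by
    rw [hmin]
    exact (iInf_le _ _).trans ((iInf_le _ hprob).trans (iInf_le _ hcx'))
  have hlt := pert_cost hρ b1 b2 b3 hε hG hH ht0 (fun u hu => (hgap u hu).1) hfin
  have h1 := como_optimal hρ (μ := μ) (η := η)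
  have h2 := Wp_le (ρ := ρ) hG hP (map_Qf μ) rfl
  exact absurd (h1.trans (hle.trans h2)) (not_le.2 hlt)
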